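/- arXiv:1207.0292 — 6 statements merged into one kernel-verified Lean document; each statement's English description precedes it below -/
import Mathlib

section
/- Let Ω ≥ 0 and t > 0 be real numbers and let g : [0,t] → ℝ be continuous. Then (1/√π) · ∫₀^t e^(−Ω(t−τ)) (t−τ)^(−1/2) g(τ) dτ = (1/π) · ∫₀^∞ θ^(−1/2) ( ∫₀^t e^(−(θ+Ω)(t−τ)) g(τ) dτ ) dθ, all the integrals involved being absolutely convergent. -/
open MeasureTheory Set Real

lemma integral_rpow_neg_half_mul_exp {s : ℝ} (hs : 0 < s) :
    ∫ θ in Ioi (0 : ℝ), θ ^ (-(1 : ℝ) / 2) * exp (-(θ * s)) = √π * s ^ (-(1 : ℝ) / 2) := by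
  have h := integral_rpow_mul_exp_neg_mul_Ioi (a := 1 / 2) (r := s) (by norm_num) hs
  rw [Gamma_one_half_eq, one_div s, inv_rpow hs.le, ← rpow_neg hs.le] at h
  norm_num at h ⊢
  simpa only [mul_comm] using h

lemma integrableOn_rpow_neg_half_mul_exp {s : ℝ} (hs : 0 < s) :
    IntegrableOn (fun θ : ℝ => θ ^ (-(1 : ℝ) / 2) * exp (-(θ * s))) (Ioi 0) :=
  .of_integral_ne_zero (by rw [integral_rpow_neg_half_mul_exp hs]; positivity)

lemma exp_neg_add_mul (θ Ω s : ℝ) : exp (-(θ + Ω) * s) = exp (-(θ * s)) * exp (-Ω * s) := by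
  rw [← exp_add]; ring_nf

lemma integral_rpow_neg_half_mul_shifted_exp (Ω c : ℝ) {s : ℝ} (hs : 0 < s) :
    ∫ θ in Ioi (0 : ℝ), θ ^ (-(1 : ℝ) / 2) * (exp (-(θ + Ω) * s) * c) =
      √π * (exp (-Ω * s) * s ^ (-(1 : ℝ) / 2) * c) := by
  have h (θ : ℝ) : θ ^ (-(1 : ℝ) / 2) * (exp (-(θ + Ω) * s) * c) =
      θ ^ (-(1 : ℝ) / 2) * exp (-(θ * s)) * (exp (-Ω * s) * c) := by
    rw [exp_neg_add_mul]; ring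
  simp_rw [h]
  rw [integral_mul_const, integral_rpow_neg_half_mul_exp hs]
  ring

lemma intervalIntegrable_exp_mul_rpow_neg_half_mul {Ω t : ℝ} (ht : 0 ≤ t) {g : ℝ → ℝ}
    (hg : ContinuousOn g (Icc 0 t)) :
    IntervalIntegrable (fun τ : ℝ => exp (-Ω * (t - τ)) * (t - τ) ^ (-(1 : ℝ) / 2) * g τ)
      volume 0 t := by
  have h : IntervalIntegrable (fun τ : ℝ => (t - τ) ^ (-(1 : ℝ) / 2)) volume 0 t := by
    simpa using ((intervalIntegral.intervalIntegrable_rpow' (a := 0) (b := t)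
      (r := -(1 : ℝ) / 2) (by norm_num)).comp_sub_left t).symm
  refine (h.continuousOn_mul (g := fun τ => exp (-Ω * (t - τ))) ?_).mul_continuousOn ?_
  · fun_prop
  · rwa [uIcc_of_le ht]

lemma integrable_prod_diffusive_kernel {Ω t : ℝ} (ht : 0 ≤ t) {g : ℝ → ℝ}
    (hg : ContinuousOn g (Icc 0 t)) :
    Integrable (Function.uncurry fun τ θ : ℝ =>
        θ ^ (-(1 : ℝ) / 2) * (exp (-(θ + Ω) * (t - τ)) * g τ))
      ((volume.restrict (Ioo 0 t)).prod (volume.restrict (Ioi 0))) := by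
  have hgm : AEStronglyMeasurable g (volume.restrict (Ioo 0 t)) :=
    (hg.mono Ioo_subset_Icc_self).aestronglyMeasurable measurableSet_Ioo
  have hmeas : AEStronglyMeasurable (Function.uncurry fun τ θ : ℝ =>
        θ ^ (-(1 : ℝ) / 2) * (exp (-(θ + Ω) * (t - τ)) * g τ))
      ((volume.restrict (Ioo 0 t)).prod (volume.restrict (Ioi 0))) := by
    refine AEStronglyMeasurable.mul (f := fun p : ℝ × ℝ => p.2 ^ (-(1 : ℝ) / 2))
      (g := fun p : ℝ × ℝ => exp (-(p.2 + Ω) * (t - p.1)) * g p.1) ?_ ?_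
    · exact (by fun_prop : Measurable _).aestronglyMeasurable
    · exact (by fun_prop : Continuous fun p : ℝ × ℝ =>
        exp (-(p.2 + Ω) * (t - p.1))).aestronglyMeasurable.mul hgm.comp_fst
  refine (integrable_prod_iff hmeas).2 ⟨?_, ?_⟩
  · filter_upwards [ae_restrict_mem measurableSet_Ioo] with τ hτ
    refine ((integrableOn_rpow_neg_half_mul_exp (sub_pos.2 hτ.2)).mul_const
      (exp (-Ω * (t - τ)) * g τ)).congr (.of_forall fun θ => ?_)
    simp only [Function.uncurry_apply_pair, exp_neg_add_mul]
    ring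
  · have h := ((intervalIntegrable_iff_integrableOn_Ioo_of_le ht).1
      (intervalIntegrable_exp_mul_rpow_neg_half_mul (Ω := Ω) ht hg.abs)).const_mul √π
    refine h.congr ?_
    filter_upwards [ae_restrict_mem measurableSet_Ioo] with τ hτ
    rw [← integral_rpow_neg_half_mul_shifted_exp Ω _ (sub_pos.2 hτ.2)]
    refine setIntegral_congr_fun measurableSet_Ioi fun θ hθ => ?_
    simp [abs_of_nonneg (rpow_nonneg (le_of_lt hθ) _)]

/-- The shifted order-1/2 fractional integral as a continuum of diffusive variables:
for `Ω ≥ 0`, `t > 0` and `g` continuous on `[0, t]`,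
`(1/√π) ∫₀^t e^(-Ω(t-τ)) (t-τ)^(-1/2) g(τ) dτ
  = (1/π) ∫₀^∞ θ^(-1/2) (∫₀^t e^(-(θ+Ω)(t-τ)) g(τ) dτ) dθ`,
all integrals being absolutely convergent. -/
theorem fractional_integral_diffusive_representation
    (Ω t : ℝ) (hΩ : 0 ≤ Ω) (ht : 0 < t)
    (g : ℝ → ℝ) (hg : ContinuousOn g (Set.Icc 0 t)) :
    IntervalIntegrable
      (fun τ : ℝ => Real.exp (-Ω * (t - τ)) * (t - τ) ^ (-(1 : ℝ) / 2) * g τ)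
      MeasureTheory.volume 0 t ∧
    MeasureTheory.IntegrableOn
      (fun θ : ℝ =>
        θ ^ (-(1 : ℝ) / 2) * ∫ τ in (0 : ℝ)..t, Real.exp (-(θ + Ω) * (t - τ)) * g τ)
      (Set.Ioi 0) ∧
    (1 / Real.sqrt Real.pi) *
        ∫ τ in (0 : ℝ)..t, Real.exp (-Ω * (t - τ)) * (t - τ) ^ (-(1 : ℝ) / 2) * g τ
      = (1 / Real.pi) *
        ∫ θ in Set.Ioi (0 : ℝ),
          θ ^ (-(1 : ℝ) / 2) * ∫ τ in (0 : ℝ)..t, Real.exp (-(θ + Ω) * (t - τ)) * g τ := by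
  have hF := integrable_prod_diffusive_kernel (Ω := Ω) ht.le hg
  have hinner (θ : ℝ) :
      θ ^ (-(1 : ℝ) / 2) * ∫ τ in (0 : ℝ)..t, Real.exp (-(θ + Ω) * (t - τ)) * g τ =
        ∫ τ in Ioo 0 t, θ ^ (-(1 : ℝ) / 2) * (Real.exp (-(θ + Ω) * (t - τ)) * g τ) := by
    rw [intervalIntegral.integral_of_le ht.le, integral_Ioc_eq_integral_Ioo, integral_const_mul]
  refine ⟨intervalIntegrable_exp_mul_rpow_neg_half_mul ht.le hg, ?_, ?_⟩
  · simp_rw [hinner]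
    exact hF.integral_prod_right
  · simp_rw [hinner]
    rw [← integral_integral_swap hF, setIntegral_congr_fun measurableSet_Ioo
      fun τ hτ => integral_rpow_neg_half_mul_shifted_exp Ω (g τ) (sub_pos.2 hτ.2),
      integral_const_mul, intervalIntegral.integral_of_le ht.le, integral_Ioc_eq_integral_Ioo,
      ← mul_assoc]
    congr 1
    have h : √π * √π = π := mul_self_sqrt pi_pos.le
    field_simp
    rw [sq, h]
end

section
/- Let N be a natural number and let ρ, ρ_f, ρ_w, λ_f, μ, m, β be real numbers with χ := ρρ_w − ρ_f² ≠ 0, and set λ₀ := λ_f − mβ². Let A be the (N+4)×(N+4) real matrix whose only nonzero entries are: A(1,3) = −ρ_w/χ, A(1,4) = −ρ_f/χ, A(2,3) = ρ_f/χ, A(2,4) = ρ/χ, A(3,1) = −(λ_f+2μ), A(3,2) = −mβ, A(4,1) = mβ, A(4,2) = m, and, for each j = 1, …, N, A(4+j,3) = ρ_f/χ and A(4+j,4) = ρ/χ. Then the characteristic polynomial of A satisfies det(x·I − A) = x^N · ( x⁴ − ((λ_f+2μ)ρ_w + m(ρ − 2ρ_fβ))/χ · x² + m(λ₀+2μ)/χ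 ). -/
open Polynomial

/-- The propagation matrix `A` of the Biot-DA first-order system with `N` diffusive
variables (unknowns `(v_s, w, σ, p, ψ₁, …, ψ_N)`), written with 0-based indices:
its only nonzero entries are
`A 0 2 = −ρ_w/χ`, `A 0 3 = −ρ_f/χ`, `A 1 2 = ρ_f/χ`, `A 1 3 = ρ/χ`,
`A 2 0 = −(λ_f+2μ)`, `A 2 1 = −mβ`, `A 3 0 = mβ`, `A 3 1 = m`, and
`A (3+j) 2 = ρ_f/χ`, `A (3+j) 3 = ρ/χ` for `j = 1, …, N`. -/
noncomputable def biotPropagationMatrix (N : ℕ) (ρ ρf ρw lf μ m β : ℝ) :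
    Matrix (Fin (N + 4)) (Fin (N + 4)) ℝ :=
  Matrix.of fun i j : Fin (N + 4) =>
    if i.val = 0 ∧ j.val = 2 then -ρw / (ρ * ρw - ρf ^ 2)
    else if i.val = 0 ∧ j.val = 3 then -ρf / (ρ * ρw - ρf ^ 2)
    else if i.val = 1 ∧ j.val = 2 then ρf / (ρ * ρw - ρf ^ 2)
    else if i.val = 1 ∧ j.val = 3 then ρ / (ρ * ρw - ρf ^ 2)
    else if i.val = 2 ∧ j.val = 0 then -(lf + 2 * μ)
    else if i.val = 2 ∧ j.val = 1 then -(m * β)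
    else if i.val = 3 ∧ j.val = 0 then m * β
    else if i.val = 3 ∧ j.val = 1 then m
    else if 4 ≤ i.val ∧ j.val = 2 then ρf / (ρ * ρw - ρf ^ 2)
    else if 4 ≤ i.val ∧ j.val = 3 then ρ / (ρ * ρw - ρf ^ 2)
    else 0

/-- The charpoly of the matrix with off-diagonal `2 × 2` blocks `P` and `Q`. -/
theorem charpoly_fin_four_offDiagonal {R : Type*} [CommRing R]
    (p₀ p₁ p₂ p₃ q₀ q₁ q₂ q₃ : R) :
    (!![0, 0, p₀, p₁; 0, 0, p₂, p₃; q₀, q₁, 0, 0; q₂, q₃, 0, 0] :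
      Matrix (Fin 4) (Fin 4) R).charpoly
      = X ^ 4 - C (p₀ * q₀ + p₁ * q₂ + p₂ * q₁ + p₃ * q₃) * X ^ 2
        + C ((p₀ * p₃ - p₁ * p₂) * (q₀ * q₃ - q₁ * q₂)) := by
  simp [Matrix.charpoly, Matrix.det_succ_row_zero, Fin.sum_univ_succ, Matrix.charmatrix_apply,
    Fin.succAbove]
  ring

/-- The last `N` columns vanish, so only the leading `4 × 4` block and the coupling of the
diffusive variables to it remain. -/
theorem biotPropagationMatrix_reindex (N : ℕ) (ρ ρf ρw lf μ m β : ℝ) :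
    (biotPropagationMatrix N ρ ρf ρw lf μ m β).submatrix
      (finSumFinEquiv.trans (finCongr (add_comm 4 N)))
      (finSumFinEquiv.trans (finCongr (add_comm 4 N)))
      = Matrix.fromBlocks
        !![0, 0, -ρw / (ρ * ρw - ρf ^ 2), -ρf / (ρ * ρw - ρf ^ 2);
           0, 0, ρf / (ρ * ρw - ρf ^ 2), ρ / (ρ * ρw - ρf ^ 2);
           -(lf + 2 * μ), -(m * β), 0, 0;
           m * β, m, 0, 0] 0
        (Matrix.of fun _ => ![0, 0, ρf / (ρ * ρw - ρf ^ 2), ρ / (ρ * ρw - ρf ^ 2)]) 0 := by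
  ext i j
  rcases i with i | i <;> rcases j with j | j
  · fin_cases i <;> fin_cases j <;> simp [biotPropagationMatrix, -Fin.val_eq_zero_iff]
  · fin_cases i <;> simp [biotPropagationMatrix, -Fin.val_eq_zero_iff]
  · fin_cases j <;> simp [biotPropagationMatrix, -Fin.val_eq_zero_iff]
  · simp [biotPropagationMatrix, -Fin.val_eq_zero_iff]

/-- Characteristic polynomial of the Biot-DA propagation matrix:
`det(X·I − A) = X^N (X⁴ − ((λ_f+2μ)ρ_w + m(ρ−2ρ_fβ))/χ · X² + m(λ₀+2μ)/χ)`,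
with `χ = ρρ_w − ρ_f²` and `λ₀ = λ_f − mβ²`. -/
theorem biotPropagationMatrix_charpoly (N : ℕ) (ρ ρf ρw lf μ m β : ℝ)
    (hχ : ρ * ρw - ρf ^ 2 ≠ 0) :
    (biotPropagationMatrix N ρ ρf ρw lf μ m β).charpoly
      = X ^ N *
        (X ^ 4 -
          C (((lf + 2 * μ) * ρw + m * (ρ - 2 * ρf * β)) / (ρ * ρw - ρf ^ 2)) * X ^ 2 +
          C (m * ((lf - m * β ^ 2) + 2 * μ) / (ρ * ρw - ρf ^ 2))) := by
  rw [← Matrix.charpoly_reindex (finSumFinEquiv.trans (finCongr (add_comm 4 N))).symm,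
    Matrix.reindex_apply, Equiv.symm_symm, biotPropagationMatrix_reindex,
    Matrix.charpoly_fromBlocks_zero₁₂, charpoly_fin_four_offDiagonal, Matrix.charpoly_zero,
    Fintype.card_fin, mul_comm]
  congr 2
  · congr 3
    field_simp
    ring
  · apply congrArg C
    generalize h : ρ * ρw - ρf ^ 2 = χ at hχ ⊢
    field_simp
    rw [← h]
    ring
end

section
/- Let ρ, ρ_f, ρ_w, λ_f, μ, m, β be real numbers with m ≠ 0 and C := λ_f + 2μ − mβ² ≠ 0. Let v, w, σ, p, d : ℝ × ℝ → ℝ be functions admitting partial derivatives ∂_t and ∂_x at every point and satisfying, at every point (x,t): ρ ∂_t v + ρ_f ∂_t w = ∂_x σ; ρ_f ∂_t v + ρ_w ∂_t w + d = −∂_x p; ∂_t σ = (λ_f+2μ) ∂_x v + mβ ∂_x w; ∂_t p = −mβ ∂_x v − m ∂_x w. Then at every point (x,t): ∂_t [ (1/2)(ρv² + ρ_w w² + 2ρ_f v w) + (1/(2C))(σ + βp)² + (1/(2m))p² ] = ∂_x ( vσ − wp ) − w·d. -/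
/-- Pointwise energy–flux balance of the 1-D Biot equations: if `v, w, σ, p` admit
partial derivatives everywhere and satisfy the Biot system with dissipation term `d`,
then `∂_t [E₁ + E₂] = ∂_x(vσ − wp) − w·d`, where the `x`-derivative of the flux is
expanded by the product rule using the given partial derivatives. -/
theorem biot_energy_flux_balance (ρ ρf ρw lf μ m β : ℝ) (hm : m ≠ 0)
    (hC : lf + 2 * μ - m * β ^ 2 ≠ 0)
    (v w σ p d vt vx wt wx σt σx pt px : ℝ → ℝ → ℝ)
    (hvt : ∀ x t, HasDerivAt (fun t' => v x t') (vt x t) t)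
    (hvx : ∀ x t, HasDerivAt (fun x' => v x' t) (vx x t) x)
    (hwt : ∀ x t, HasDerivAt (fun t' => w x t') (wt x t) t)
    (hwx : ∀ x t, HasDerivAt (fun x' => w x' t) (wx x t) x)
    (hσt : ∀ x t, HasDerivAt (fun t' => σ x t') (σt x t) t)
    (hσx : ∀ x t, HasDerivAt (fun x' => σ x' t) (σx x t) x)
    (hpt : ∀ x t, HasDerivAt (fun t' => p x t') (pt x t) t)
    (hpx : ∀ x t, HasDerivAt (fun x' => p x' t) (px x t) x)
    (h1 : ∀ x t, ρ * vt x t + ρf * wt x t = σx x t)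
    (h2 : ∀ x t, ρf * vt x t + ρw * wt x t + d x t = -(px x t))
    (h3 : ∀ x t, σt x t = (lf + 2 * μ) * vx x t + m * β * wx x t)
    (h4 : ∀ x t, pt x t = -(m * β) * vx x t - m * wx x t) :
    ∀ x t, HasDerivAt
      (fun t' =>
        (1 / 2) * (ρ * (v x t') ^ 2 + ρw * (w x t') ^ 2 + 2 * ρf * v x t' * w x t') +
        (1 / (2 * (lf + 2 * μ - m * β ^ 2))) * (σ x t' + β * p x t') ^ 2 +
        (1 / (2 * m)) * (p x t') ^ 2)
      (vx x t * σ x t + v x t * σx x t - wx x t * p x t - w x t * px x t -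
        w x t * d x t) t := by
  intro x t
  have hK := ((((hvt x t).pow 2).const_mul ρ).add (((hwt x t).pow 2).const_mul ρw)).add
    (((hvt x t).const_mul (2 * ρf)).mul (hwt x t))
  have hS := ((hσt x t).add ((hpt x t).const_mul β)).pow 2
  have hE := ((hK.const_mul (1 / 2)).add
    (hS.const_mul (1 / (2 * (lf + 2 * μ - m * β ^ 2))))).add
      (((hpt x t).pow 2).const_mul (1 / (2 * m)))
  refine hE.congr_deriv ?_
  have hstress : σt x t + β * pt x t = (lf + 2 * μ - m * β ^ 2) * vx x t := by
    rw [h3, h4]; ring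
  have hstrain : 1 / (2 * (lf + 2 * μ - m * β ^ 2)) *
      (2 * (σ x t + β * p x t) * (σt x t + β * pt x t)) =
        (σ x t + β * p x t) * vx x t := by
    rw [hstress]; field_simp
  have hfluid : 1 / (2 * m) * (2 * p x t * pt x t) = -(p x t * (β * vx x t + wx x t)) := by
    rw [h4]; field_simp; ring
  simp only [Pi.add_apply, Nat.cast_ofNat, Nat.add_one_sub_one, pow_one]
  linear_combination hstrain + hfluid + v x t * h1 x t + w x t * h2 x t
end

section
/- Let N ≥ 1 be a natural number and ρ, ρ_f, ρ_w, λ_f, μ, m, β, η, κ, Ω, γ, a₁,…,a_N, θ₁,…,θ_N be real numbers with ρ ≠ 0, χ := ρρ_w − ρ_f² ≠ 0, m ≠ 0, C := λ_f + 2μ − mβ² ≠ 0, κ ≠ 0, Ω > 0, θ_ℓ + 2Ω ≠ 0 for all ℓ, and γ = (η/κ)(ρ/χ)(1/√Ω). Let v, w, σ, p, ψ₁, …, ψ_N : ℝ × ℝ → ℝ admit partial derivatives ∂_t and ∂_x at every point and satisfy, at every point: ∂_t v − (ρ_w/χ)∂_x σ − (ρ_f/χ)∂_x p = (ρ_f/ρ)γ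 Σ_{ℓ=1}^N a_ℓ ψ_ℓ; ∂_t w + (ρ_f/χ)∂_x σ + (ρ/χ)∂_x p = −γ Σ_{ℓ=1}^N a_ℓ ψ_ℓ; ∂_t σ = (λ_f+2μ)∂_x v + mβ ∂_x w; ∂_t p = −mβ ∂_x v − m ∂_x w; and, for each j = 1,…,N, ∂_t ψ_j + (ρ_f/χ)∂_x σ + (ρ/χ)∂_x p = Ω w − γ Σ_{ℓ=1}^N a_ℓ ψ_ℓ − (θ_j+Ω)ψ_j. Define the energy density e := (1/2)(ρv² + ρ_w w² + 2ρ_f vw) + (1/(2C))(σ+βp)² + (1/(2m))p² + (1/2)(η/κ)(1/√Ω) Σ_{ℓ=1}^N (a_ℓ/(θ_ℓ+2Ω))(w − ψ_ℓ)². Then at every point: ∂_t e = ∂_x (vσ − wp) − (η/κ)(1/√Ω) Σ_{ℓ=1}^N (a_ℓ/(θ_ℓ+2Ω)) ( Ω w² + (θ_ℓ+Ω)ψ_ℓ² ). -/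
open Finset

/-- Pointwise energy balance of the Biot-DA system with `N` diffusive variables
(Proposition 2 of the paper, in local conservation-law form):
`∂_t e = ∂_x(vσ − wp) − (η/κ)(1/√Ω) Σ_ℓ (a_ℓ/(θ_ℓ+2Ω))(Ωw² + (θ_ℓ+Ω)ψ_ℓ²)`. -/
theorem biotDA_energy_balance (N : ℕ) (hN : 1 ≤ N)
    (ρ ρf ρw lf μ m β η κ Ω γ : ℝ) (a θ : Fin N → ℝ)
    (hρ : ρ ≠ 0) (hχ : ρ * ρw - ρf ^ 2 ≠ 0) (hm : m ≠ 0)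
    (hC : lf + 2 * μ - m * β ^ 2 ≠ 0) (hκ : κ ≠ 0) (hΩ : 0 < Ω)
    (hθ : ∀ ℓ, θ ℓ + 2 * Ω ≠ 0)
    (hγ : γ = (η / κ) * (ρ / (ρ * ρw - ρf ^ 2)) * (1 / Real.sqrt Ω))
    (v w σ p vt vx wt wx σt σx pt px : ℝ → ℝ → ℝ)
    (ψ ψt ψx : Fin N → ℝ → ℝ → ℝ)
    (hvt : ∀ x t, HasDerivAt (fun t' => v x t') (vt x t) t)
    (hvx : ∀ x t, HasDerivAt (fun x' => v x' t) (vx x t) x)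
    (hwt : ∀ x t, HasDerivAt (fun t' => w x t') (wt x t) t)
    (hwx : ∀ x t, HasDerivAt (fun x' => w x' t) (wx x t) x)
    (hσt : ∀ x t, HasDerivAt (fun t' => σ x t') (σt x t) t)
    (hσx : ∀ x t, HasDerivAt (fun x' => σ x' t) (σx x t) x)
    (hpt : ∀ x t, HasDerivAt (fun t' => p x t') (pt x t) t)
    (hpx : ∀ x t, HasDerivAt (fun x' => p x' t) (px x t) x)
    (hψt : ∀ j x t, HasDerivAt (fun t' => ψ j x t') (ψt j x t) t)
    (hψx : ∀ j x t, HasDerivAt (fun x' => ψ j x' t) (ψx j x t) x)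
    (h1 : ∀ x t, vt x t - (ρw / (ρ * ρw - ρf ^ 2)) * σx x t -
        (ρf / (ρ * ρw - ρf ^ 2)) * px x t
        = (ρf / ρ) * γ * ∑ ℓ, a ℓ * ψ ℓ x t)
    (h2 : ∀ x t, wt x t + (ρf / (ρ * ρw - ρf ^ 2)) * σx x t +
        (ρ / (ρ * ρw - ρf ^ 2)) * px x t
        = -(γ * ∑ ℓ, a ℓ * ψ ℓ x t))
    (h3 : ∀ x t, σt x t = (lf + 2 * μ) * vx x t + m * β * wx x t)
    (h4 : ∀ x t, pt x t = -(m * β) * vx x t - m * wx x t)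
    (h5 : ∀ j x t, ψt j x t + (ρf / (ρ * ρw - ρf ^ 2)) * σx x t +
        (ρ / (ρ * ρw - ρf ^ 2)) * px x t
        = Ω * w x t - γ * (∑ ℓ, a ℓ * ψ ℓ x t) - (θ j + Ω) * ψ j x t) :
    ∀ x t, HasDerivAt
      (fun t' =>
        (1 / 2) * (ρ * (v x t') ^ 2 + ρw * (w x t') ^ 2 + 2 * ρf * v x t' * w x t') +
        (1 / (2 * (lf + 2 * μ - m * β ^ 2))) * (σ x t' + β * p x t') ^ 2 +
        (1 / (2 * m)) * (p x t') ^ 2 +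
        (1 / 2) * (η / κ) * (1 / Real.sqrt Ω) *
          ∑ ℓ, (a ℓ / (θ ℓ + 2 * Ω)) * (w x t' - ψ ℓ x t') ^ 2)
      (vx x t * σ x t + v x t * σx x t - wx x t * p x t - w x t * px x t -
        (η / κ) * (1 / Real.sqrt Ω) *
          ∑ ℓ, (a ℓ / (θ ℓ + 2 * Ω)) *
            (Ω * (w x t) ^ 2 + (θ ℓ + Ω) * (ψ ℓ x t) ^ 2)) t := by
  intro x t
  have hsum : HasDerivAt
      (fun t' => ∑ ℓ, (a ℓ / (θ ℓ + 2 * Ω)) * (w x t' - ψ ℓ x t') ^ 2)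
      (∑ ℓ, (2 * (a ℓ * ψ ℓ x t * w x t) - 2 * ((a ℓ / (θ ℓ + 2 * Ω)) *
            (Ω * (w x t) ^ 2 + (θ ℓ + Ω) * (ψ ℓ x t) ^ 2)))) t := by
    refine HasDerivAt.fun_sum fun ℓ _ => ?_
    refine ((((hwt x t).sub (hψt ℓ x t)).pow 2).const_mul
      (a ℓ / (θ ℓ + 2 * Ω))).congr_deriv ?_
    have hdiff : wt x t - ψt ℓ x t = -Ω * w x t + (θ ℓ + Ω) * ψ ℓ x t := by
      linear_combination h2 x t - h5 ℓ x t
    have hθℓ := hθ ℓ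
    simp only [Pi.sub_apply, hdiff]
    field_simp
    push_cast
    ring
  rw [Finset.sum_sub_distrib, ← Finset.mul_sum, ← Finset.mul_sum, ← Finset.sum_mul] at hsum
  have hkin := (((((hvt x t).pow 2).const_mul ρ).add (((hwt x t).pow 2).const_mul ρw)).add
    (((hvt x t).const_mul (2 * ρf)).mul (hwt x t))).const_mul (1 / 2)
  have hel := (((hσt x t).add ((hpt x t).const_mul β)).pow 2).const_mul
    (1 / (2 * (lf + 2 * μ - m * β ^ 2)))
  have hpr := ((hpt x t).pow 2).const_mul (1 / (2 * m))
  refine (((hkin.add hel).add hpr).add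
    (hsum.const_mul ((1 / 2) * (η / κ) * (1 / Real.sqrt Ω)))).congr_deriv ?_
  have e1 := h1 x t
  have e2 := h2 x t
  generalize (∑ ℓ, a ℓ * ψ ℓ x t) = S at *
  generalize (∑ ℓ, (a ℓ / (θ ℓ + 2 * Ω)) *
    (Ω * (w x t) ^ 2 + (θ ℓ + Ω) * (ψ ℓ x t) ^ 2)) = D at *
  have hK : (η / κ) * (1 / Real.sqrt Ω) = γ * (ρ * ρw - ρf ^ 2) / ρ := by
    rw [hγ]
    generalize 1 / Real.sqrt Ω = r
    field_simp
  have hv : ρ * vt x t + ρf * wt x t = σx x t := by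
    rw [eq_sub_of_add_eq (eq_sub_of_add_eq e2), sub_eq_iff_eq_add.1 (sub_eq_iff_eq_add.1 e1)]
    field_simp
    ring
  have hw : ρw * wt x t + ρf * vt x t =
      -px x t - (η / κ) * (1 / Real.sqrt Ω) * S := by
    rw [hK]
    linear_combination ρw * e2 + ρf * e1 - px x t * mul_inv_cancel₀ hχ +
      γ * S * ρw * mul_inv_cancel₀ hρ
  have hs : 1 / (2 * (lf + 2 * μ - m * β ^ 2)) * (2 * (σ x t + β * p x t) *
      (σt x t + β * pt x t)) = (σ x t + β * p x t) * vx x t := by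
    rw [h3, h4]
    field_simp
    ring
  have hp : 1 / (2 * m) * (2 * p x t * pt x t) = p x t * (-β * vx x t - wx x t) := by
    rw [h4]
    field_simp
  simp only [Pi.add_apply, Nat.cast_ofNat, Nat.add_one_sub_one, pow_one]
  linear_combination v x t * hv + w x t * hw + hs + hp
end

section
/- Let ρ, ρ_f, ρ_w, λ_f, μ, m, β, η, κ, Ω be real numbers with m ≠ 0, C := λ_f + 2μ − mβ² ≠ 0, κ ≠ 0 and Ω > 0. Let v, w, σ, p : ℝ × ℝ → ℝ admit partial derivatives ∂_t and ∂_x at every point, and let ψ : ℝ × (0,∞) × ℝ → ℝ, (x,θ,t) ↦ ψ(x,θ,t), be such that, for each (x,θ,t): ∂_t ψ(x,θ,t) = −(θ+Ω)ψ(x,θ,t) + ∂_t w(x,t) + Ω w(x,t). Assume that at every (x,t) the functions θ ↦ θ^(−1/2) ψ(x,θ,t), θ ↦ θ^(−1/2)(θ+2Ω)^(−1) w(x,t) ψ(x,θ,t), and θ ↦ θ^(−1/2)(θ+2Ω)^(−1)(Ω w(x,t)² + (θ+Ω)ψ(x,θ,t)²) are Lebesgue integrable on (0,∞), and that t ↦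 ∫₀^∞ θ^(−1/2)(θ+2Ω)^(−1)(w(x,t) − ψ(x,θ,t))² dθ is differentiable with derivative ∫₀^∞ θ^(−1/2)(θ+2Ω)^(−1) · 2(w − ψ)(∂_t w − ∂_t ψ) dθ (differentiation under the integral sign). Assume moreover that at every point: ρ ∂_t v + ρ_f ∂_t w = ∂_x σ; ρ_f ∂_t v + ρ_w ∂_t w + (η/κ)(1/(π√Ω)) ∫₀^∞ θ^(−1/2) ψ(x,θ,t) dθ = −∂_x p; ∂_t σ = (λ_f+2μ)∂_x v + mβ ∂_x w; ∂_t p = −mβ ∂_x v − m ∂_x w. Define e(x,t) := (1/2)(ρv² + ρ_w w² + 2ρ_f vw) + (1/(2C))(σ+βp)² + (1/(2m))p² + (1/2)(η/κ)(1/(π√Ω)) ∫₀^∞ θ^(−1/2)(θ+2Ω)^(−1)(w − ψ(x,θ,t))² dθ. Then at every point (x,t): ∂_t e = ∂_x (vσ − wp) − (η/κ)(1/(π√Ω)) ∫₀^∞ θ^(−1/2)(θ+2Ω)^(−1) ( Ω w² + (θ+Ω)ψ(x,θ,t)² ) dθ. -/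
/-- Pointwise energy balance of the Biot-JKD model (Proposition 1 of the paper),
with the shifted fractional derivative `(D+Ω)^{1/2}w` replaced by its diffusive
representation `(1/π)∫₀^∞ θ^(−1/2) ψ(x,θ,t) dθ`:
`∂_t e = ∂_x(vσ − wp) − (η/κ)(1/(π√Ω)) ∫₀^∞ θ^(−1/2)(θ+2Ω)^(−1)(Ωw² + (θ+Ω)ψ²) dθ`. -/
theorem biotJKD_energy_balance (ρ ρf ρw lf μ m β η κ Ω : ℝ)
    (hm : m ≠ 0) (hC : lf + 2 * μ - m * β ^ 2 ≠ 0) (hκ : κ ≠ 0) (hΩ : 0 < Ω)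
    (v w σ p vt vx wt wx σt σx pt px : ℝ → ℝ → ℝ)
    (ψ ψt : ℝ → ℝ → ℝ → ℝ)
    (hvt : ∀ x t, HasDerivAt (fun t' => v x t') (vt x t) t)
    (hvx : ∀ x t, HasDerivAt (fun x' => v x' t) (vx x t) x)
    (hwt : ∀ x t, HasDerivAt (fun t' => w x t') (wt x t) t)
    (hwx : ∀ x t, HasDerivAt (fun x' => w x' t) (wx x t) x)
    (hσt : ∀ x t, HasDerivAt (fun t' => σ x t') (σt x t) t)
    (hσx : ∀ x t, HasDerivAt (fun x' => σ x' t) (σx x t) x)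
    (hpt : ∀ x t, HasDerivAt (fun t' => p x t') (pt x t) t)
    (hpx : ∀ x t, HasDerivAt (fun x' => p x' t) (px x t) x)
    (hψt : ∀ x t, ∀ θ ∈ Set.Ioi (0 : ℝ),
      HasDerivAt (fun t' => ψ x θ t') (ψt x θ t) t)
    (hODE : ∀ x t, ∀ θ ∈ Set.Ioi (0 : ℝ),
      ψt x θ t = -(θ + Ω) * ψ x θ t + wt x t + Ω * w x t)
    (hint1 : ∀ x t, MeasureTheory.IntegrableOn
      (fun θ : ℝ => θ ^ (-(1 : ℝ) / 2) * ψ x θ t) (Set.Ioi 0))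
    (hint2 : ∀ x t, MeasureTheory.IntegrableOn
      (fun θ : ℝ => θ ^ (-(1 : ℝ) / 2) * (θ + 2 * Ω)⁻¹ * (w x t * ψ x θ t))
      (Set.Ioi 0))
    (hint3 : ∀ x t, MeasureTheory.IntegrableOn
      (fun θ : ℝ => θ ^ (-(1 : ℝ) / 2) * (θ + 2 * Ω)⁻¹ *
        (Ω * (w x t) ^ 2 + (θ + Ω) * (ψ x θ t) ^ 2)) (Set.Ioi 0))
    (hdiff : ∀ x t, HasDerivAt
      (fun t' => ∫ θ in Set.Ioi (0 : ℝ),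
        θ ^ (-(1 : ℝ) / 2) * (θ + 2 * Ω)⁻¹ * (w x t' - ψ x θ t') ^ 2)
      (∫ θ in Set.Ioi (0 : ℝ),
        θ ^ (-(1 : ℝ) / 2) * (θ + 2 * Ω)⁻¹ *
          (2 * (w x t - ψ x θ t) * (wt x t - ψt x θ t))) t)
    (h1 : ∀ x t, ρ * vt x t + ρf * wt x t = σx x t)
    (h2 : ∀ x t, ρf * vt x t + ρw * wt x t +
        (η / κ) * (1 / (Real.pi * Real.sqrt Ω)) *
          ∫ θ in Set.Ioi (0 : ℝ), θ ^ (-(1 : ℝ) / 2) * ψ x θ t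
        = -(px x t))
    (h3 : ∀ x t, σt x t = (lf + 2 * μ) * vx x t + m * β * wx x t)
    (h4 : ∀ x t, pt x t = -(m * β) * vx x t - m * wx x t) :
    ∀ x t, HasDerivAt
      (fun t' =>
        (1 / 2) * (ρ * (v x t') ^ 2 + ρw * (w x t') ^ 2 + 2 * ρf * v x t' * w x t') +
        (1 / (2 * (lf + 2 * μ - m * β ^ 2))) * (σ x t' + β * p x t') ^ 2 +
        (1 / (2 * m)) * (p x t') ^ 2 +
        (1 / 2) * (η / κ) * (1 / (Real.pi * Real.sqrt Ω)) *
          ∫ θ in Set.Ioi (0 : ℝ),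
            θ ^ (-(1 : ℝ) / 2) * (θ + 2 * Ω)⁻¹ * (w x t' - ψ x θ t') ^ 2)
      (vx x t * σ x t + v x t * σx x t - wx x t * p x t - w x t * px x t -
        (η / κ) * (1 / (Real.pi * Real.sqrt Ω)) *
          ∫ θ in Set.Ioi (0 : ℝ),
            θ ^ (-(1 : ℝ) / 2) * (θ + 2 * Ω)⁻¹ *
              (Ω * (w x t) ^ 2 + (θ + Ω) * (ψ x θ t) ^ 2)) t := by
  intro x t
  have hdissipation : (∫ θ in Set.Ioi (0 : ℝ), θ ^ (-(1 : ℝ) / 2) * (θ + 2 * Ω)⁻¹ *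
        (2 * (w x t - ψ x θ t) * (wt x t - ψt x θ t)))
      = 2 * w x t * (∫ θ in Set.Ioi (0 : ℝ), θ ^ (-(1 : ℝ) / 2) * ψ x θ t) -
        2 * ∫ θ in Set.Ioi (0 : ℝ), θ ^ (-(1 : ℝ) / 2) * (θ + 2 * Ω)⁻¹ *
          (Ω * (w x t) ^ 2 + (θ + Ω) * (ψ x θ t) ^ 2) := by
    rw [← MeasureTheory.integral_const_mul, ← MeasureTheory.integral_const_mul,
      ← MeasureTheory.integral_sub ((hint1 x t).const_mul _) ((hint3 x t).const_mul _)]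
    refine MeasureTheory.setIntegral_congr_fun measurableSet_Ioi fun θ hθ => ?_
    have hθΩ : θ + 2 * Ω ≠ 0 := by
      have : 0 < θ := hθ
      positivity
    simp only [hODE x t θ hθ]
    field_simp
    ring
  have hdiff' := hdiff x t
  rw [hdissipation] at hdiff'
  have hkinetic := (((((hvt x t).pow 2).const_mul ρ).add (((hwt x t).pow 2).const_mul ρw)).add
    (((hvt x t).const_mul (2 * ρf)).mul (hwt x t))).const_mul (1 / 2)
  have hstrain := (((hσt x t).add ((hpt x t).const_mul β)).pow 2).const_mul
    (1 / (2 * (lf + 2 * μ - m * β ^ 2)))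
  have hpressure := ((hpt x t).pow 2).const_mul (1 / (2 * m))
  have hmemory := hdiff'.const_mul ((1 / 2) * (η / κ) * (1 / (Real.pi * Real.sqrt Ω)))
  refine (((hkinetic.add hstrain).add hpressure).add hmemory).congr_deriv ?_
  have hstrain_eq : 1 / (2 * (lf + 2 * μ - m * β ^ 2)) *
      (2 * (σ x t + β * p x t) * (σt x t + β * pt x t)) = (σ x t + β * p x t) * vx x t := by
    rw [h3, h4]
    field_simp
    ring
  have hpressure_eq : 1 / (2 * m) * (2 * p x t * pt x t) =
      -(β * p x t * vx x t) - p x t * wx x t := by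
    rw [h4]
    field_simp
  simp only [Pi.add_apply, Nat.cast_ofNat, Nat.add_one_sub_one, pow_one]
  linear_combination hstrain_eq + hpressure_eq + v x t * h1 x t + w x t * h2 x t
end

section
/- Let N ≥ 1 be a natural number and γ, Ω, a₁,…,a_N, θ₁,…,θ_N be real numbers. Let w, ψ₁, …, ψ_N : ℝ → ℝ be differentiable functions satisfying, for every t: w′(t) = −γ Σ_{ℓ=1}^N a_ℓ ψ_ℓ(t) and, for each j = 1,…,N, ψ_j′(t) = Ω w(t) − γ Σ_{ℓ=1}^N a_ℓ ψ_ℓ(t) − (θ_j+Ω) ψ_j(t). Then the function E(t) := Σ_{j=1}^N (1/2)(w(t) − ψ_j(t))² is differentiable with E′(t) = − Σ_{j=1}^N ( Ω w(t)² − (θ_j+2Ω) w(t) ψ_j(t) + (θ_j+Ω) ψ_j(t)² ) for every t. -/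
open Finset

/-- Energy identity for the diffusive (relaxation) part of the splitting of the
Biot-DA system (Proposition 3 of the paper): if `w' = −γ Σ a_ℓ ψ_ℓ` and
`ψ_j' = Ωw − γ Σ a_ℓ ψ_ℓ − (θ_j+Ω)ψ_j`, then
`E = Σ_j (1/2)(w − ψ_j)²` satisfies
`E' = −Σ_j (Ωw² − (θ_j+2Ω)wψ_j + (θ_j+Ω)ψ_j²)`. -/
theorem biotDA_diffusive_step_energy (N : ℕ) (hN : 1 ≤ N)
    (γ Ω : ℝ) (a θ : Fin N → ℝ)
    (w : ℝ → ℝ) (ψ : Fin N → ℝ → ℝ)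
    (hw : ∀ t, HasDerivAt w (-(γ * ∑ ℓ, a ℓ * ψ ℓ t)) t)
    (hψ : ∀ j t, HasDerivAt (ψ j)
      (Ω * w t - γ * (∑ ℓ, a ℓ * ψ ℓ t) - (θ j + Ω) * ψ j t) t) :
    ∀ t, HasDerivAt (fun t' => ∑ j, (1 / 2) * (w t' - ψ j t') ^ 2)
      (-∑ j, (Ω * (w t) ^ 2 - (θ j + 2 * Ω) * w t * ψ j t +
        (θ j + Ω) * (ψ j t) ^ 2)) t := by
  intro t
  rw [← Finset.sum_neg_distrib]
  refine HasDerivAt.fun_sum fun j _ => ?_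
  refine ((((hw t).fun_sub (hψ j t)).fun_pow 2).const_mul (1 / 2 : ℝ)).congr_deriv ?_
  push_cast
  ring
end
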